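/- For every α ∈ (0,∞) there exist constants A₁, A₂, A₃ ∈ (0,∞) depending only on α such that for every a ∈ (0,1/2], every b ∈ (a,1] and every ε ∈ (0,1/2] there exists a function f̃ ∈ F^FNN_1( A₁·log(1/ε) + 139·log(1/a), A₂·(1/ε)^(1/α)·log(1/a), A₃·(1/ε)^(1/α)·log(1/ε)·log(1/a) + 65440·(log(1/a))², 1, ∞ ) satisfying sup_{z ∈ [a,b]} |log z − f̃(z)| ≤ ε and log a ≤ f̃(t) ≤ log b for all t ∈ ℝ. -/

import Mathlib

open MeasureTheory
open scoped ENNReal NNReal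

namespace DNNLogistic

noncomputable section

/-- The unit cube `[0,1]^d` as a subset of `ℝ^d`. -/
def cube (d : ℕ) : Set (Fin d → ℝ) := {x | ∀ i, x i ∈ Set.Icc (0 : ℝ) 1}

/-- The logistic loss `φ(t) = log (1 + e^{-t})`. -/
def logLoss (t : ℝ) : ℝ := Real.log (1 + Real.exp (-t))

/-- `sgn(t) = 1` if `t ≥ 0`, `sgn(t) = -1` otherwise. -/
def rsgn (t : ℝ) : ℝ := if 0 ≤ t then 1 else -1

/-- The Euclidean distance `‖x - z‖₂` on `ℝ^m`. -/
def eucDist {m : ℕ} (x z : Fin m → ℝ) : ℝ := Real.sqrt (∑ i, (x i - z i) ^ 2)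

/-- The logistic risk `R^φ_{η,Q}(f)` of `f` with respect to the conditional probability
function `η` and the marginal distribution `Q` on `[0,1]^d`. -/
def logRisk (d : ℕ) (Q : Measure (Fin d → ℝ)) (η f : (Fin d → ℝ) → ℝ) : ℝ :=
  ∫ x, (η x * logLoss (f x) + (1 - η x) * logLoss (-f x)) ∂Q

/-- The infimum of the logistic risk over all Borel measurable real-valued functions. -/
def infLogRisk (d : ℕ) (Q : Measure (Fin d → ℝ)) (η : (Fin d → ℝ) → ℝ) : ℝ :=
  sInf {t | ∃ g : (Fin d → ℝ) → ℝ, Measurable g ∧ t = logRisk d Q η g}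

/-- The excess logistic risk `E^φ_{η,Q}(f)`. -/
def excessLogRisk (d : ℕ) (Q : Measure (Fin d → ℝ)) (η f : (Fin d → ℝ) → ℝ) : ℝ :=
  logRisk d Q η f - infLogRisk d Q η

/-- The misclassification risk `R_{η,Q}(f)`; note `1{sgn(f x) = -1} = 1{f x < 0}` and
`1{sgn(f x) = 1} = 1{0 ≤ f x}`. -/
def misRisk (d : ℕ) (Q : Measure (Fin d → ℝ)) (η f : (Fin d → ℝ) → ℝ) : ℝ :=
  ∫ x, (η x * (if f x < 0 then (1 : ℝ) else 0)
      + (1 - η x) * (if 0 ≤ f x then (1 : ℝ) else 0)) ∂Q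

/-- The infimum of the misclassification risk over all Borel measurable functions. -/
def infMisRisk (d : ℕ) (Q : Measure (Fin d → ℝ)) (η : (Fin d → ℝ) → ℝ) : ℝ :=
  sInf {t | ∃ g : (Fin d → ℝ) → ℝ, Measurable g ∧ t = misRisk d Q η g}

/-- The excess misclassification error `E_{η,Q}(f)`. -/
def excessMisRisk (d : ℕ) (Q : Measure (Fin d → ℝ)) (η f : (Fin d → ℝ) → ℝ) : ℝ :=
  misRisk d Q η f - infMisRisk d Q η

/-- The joint distribution `P_{η,Q}` on `ℝ^d × ℝ`: the marginal on the first factor is `Q`,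
and the conditional distribution of the label given `x` puts mass `η x` on `1` and mass
`1 - η x` on `-1`.  It satisfies `P_{η,Q}(S) = ∫ (η x • 1_S(x,1) + (1 - η x) • 1_S(x,-1)) dQ`. -/
def PeQ (d : ℕ) (Q : Measure (Fin d → ℝ)) (η : (Fin d → ℝ) → ℝ) :
    Measure ((Fin d → ℝ) × ℝ) :=
  (Q.withDensity fun x => ENNReal.ofReal (η x)).map (fun x => (x, (1 : ℝ)))
    + (Q.withDensity fun x => ENNReal.ofReal (1 - η x)).map (fun x => (x, (-1 : ℝ)))

/-- The logistic risk `R^φ_P(f)` with respect to a joint distribution `P` on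
`[0,1]^d × {-1,1}`. -/
def jointLogRisk (d : ℕ) (P : Measure ((Fin d → ℝ) × ℝ)) (f : (Fin d → ℝ) → ℝ) : ℝ :=
  ∫ z, logLoss (z.2 * f z.1) ∂P

/-- The Lebesgue measure on the cube `[0,1]^d`. -/
def cubeVolume (d : ℕ) : Measure (Fin d → ℝ) := volume.restrict (cube d)

/-- The `n`-fold product measure `P^{⊗n}` on the sample space. -/
def nSample (d n : ℕ) (P : Measure ((Fin d → ℝ) × ℝ)) :
    Measure (Fin n → (Fin d → ℝ) × ℝ) :=
  Measure.pi fun _ => P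

/-- `fhat` is an empirical logistic-risk minimizer over the class `Fcls` from samples of
size `n`: it is jointly Borel measurable, and for every sample
`z ∈ ([0,1]^d × {-1,1})^n` the function `fhat z` belongs to `Fcls` and minimizes the
empirical logistic risk over `Fcls`. -/
def IsERM (d n : ℕ) (Fcls : Set ((Fin d → ℝ) → ℝ))
    (fhat : (Fin n → (Fin d → ℝ) × ℝ) → (Fin d → ℝ) → ℝ) : Prop :=
  Measurable (fun p : (Fin n → (Fin d → ℝ) × ℝ) × (Fin d → ℝ) => fhat p.1 p.2) ∧
  ∀ z : Fin n → (Fin d → ℝ) × ℝ, (∀ i, z i ∈ (cube d) ×ˢ ({-1, 1} : Set ℝ)) →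
    fhat z ∈ Fcls ∧
    ∀ f ∈ Fcls,
      ∑ i, logLoss ((z i).2 * fhat z ((z i).1)) ≤ ∑ i, logLoss ((z i).2 * f ((z i).1))

/-- The successive hidden layers of a fully connected ReLU network:
`u₀ = x` and `u_{k+1} = σ_{v_{k+1}}(W_k u_k)`. -/
def fnnHidden (m : ℕ → ℕ) (W : ∀ k : ℕ, Matrix (Fin (m (k + 1))) (Fin (m k)) ℝ)
    (v : ∀ k : ℕ, Fin (m k) → ℝ) : (k : ℕ) → (Fin (m 0) → ℝ) → (Fin (m k) → ℝ)
  | 0 => fun x => x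
  | (k + 1) => fun x j => max ((W k).mulVec (fnnHidden m W v k x) j - v (k + 1) j) 0

/-- `f ∈ F^FNN_d(G, N, S, B, F)`: `f : ℝ^d → ℝ` is realized by a fully connected ReLU
network `x ↦ W_L σ_{v_L} W_{L-1} ⋯ W_1 σ_{v_1} W_0 x` with depth `L ≤ G`, hidden widths
at most `N`, at most `S` nonzero entries among all weight matrices and bias vectors, all
entries bounded by `B` in absolute value, and `sup_{x ∈ [0,1]^d} |f x| ≤ F`. -/
def IsFNN (d : ℕ) (G N S B : ℝ) (F : ℝ≥0∞) (f : (Fin d → ℝ) → ℝ) : Prop :=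
  ∃ (L : ℕ) (m : ℕ → ℕ) (W : ∀ k : ℕ, Matrix (Fin (m (k + 1))) (Fin (m k)) ℝ)
    (v : ∀ k : ℕ, Fin (m k) → ℝ) (hm0 : m 0 = d) (hmL : m (L + 1) = 1),
    1 ≤ L ∧ (L : ℝ) ≤ G ∧
    (∀ k : ℕ, 1 ≤ k → k ≤ L → (m k : ℝ) ≤ N) ∧
    (((∑ k ∈ Finset.range (L + 1),
          Set.ncard {p : Fin (m (k + 1)) × Fin (m k) | W k p.1 p.2 ≠ 0}) +
        (∑ k ∈ Finset.Icc 1 L, Set.ncard {j : Fin (m k) | v k j ≠ 0}) : ℝ) ≤ S) ∧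
    (∀ k : ℕ, k ≤ L → ∀ i j, |W k i j| ≤ B) ∧
    (∀ k : ℕ, 1 ≤ k → k ≤ L → ∀ j, |v k j| ≤ B) ∧
    (∀ x ∈ cube d, ENNReal.ofReal |f x| ≤ F) ∧
    (∀ x : Fin d → ℝ,
      f x = (W L).mulVec (fnnHidden m W v L fun i => x (Fin.cast hm0 i)) (Fin.cast hmL.symm 0))

/-- The partial derivative (within the cube) of `f` in the `i`-th coordinate direction. -/
def pderivW (m : ℕ) (i : Fin m) (f : (Fin m → ℝ) → ℝ) : (Fin m → ℝ) → ℝ :=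
  fun x => fderivWithin ℝ f (cube m) x (Pi.single i 1)

/-- The iterated partial derivative of `f` along the list of coordinate directions `l`. -/
def derivListW (m : ℕ) : List (Fin m) → ((Fin m → ℝ) → ℝ) → ((Fin m → ℝ) → ℝ)
  | [], f => f
  | (i :: l), f => derivListW m l (pderivW m i f)

/-- Membership in the Hölder ball `B^β_r([0,1]^m)`: with `k = ⌈β⌉ - 1` and
`λ = β - ⌈β⌉ + 1`, `f` has continuous partial derivatives (within the cube) up to order
`k`, and the maximum of the sup-norms of its derivatives of order at most `k` plus the
maximum of the Hölder-`λ` seminorms of its derivatives of order `k` is at most `r`. -/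
def MemHolderBall (m : ℕ) (β r : ℝ) (f : (Fin m → ℝ) → ℝ) : Prop :=
  (∀ l : List (Fin m), l.length < ⌈β⌉₊ - 1 →
    DifferentiableOn ℝ (derivListW m l f) (cube m)) ∧
  (∀ l : List (Fin m), l.length ≤ ⌈β⌉₊ - 1 →
    ContinuousOn (derivListW m l f) (cube m)) ∧
  ∃ A Bc : ℝ, A + Bc ≤ r ∧
    (∀ l : List (Fin m), l.length ≤ ⌈β⌉₊ - 1 → ∀ x ∈ cube m, |derivListW m l f x| ≤ A) ∧
    (∀ l : List (Fin m), l.length = ⌈β⌉₊ - 1 → ∀ x ∈ cube m, ∀ z ∈ cube m, x ≠ z →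
      |derivListW m l f x - derivListW m l f z| ≤ Bc * eucDist x z ^ (β - (⌈β⌉₊ : ℝ) + 1))

/-- `f ∈ G^M_d(dmax)`: on `[0,1]^d`, `f` computes the maximum of at most `dmax` of its
input coordinates. -/
def GM (d dmax : ℕ) (f : (Fin d → ℝ) → ℝ) : Prop :=
  ∃ (I : Finset (Fin d)) (hI : I.Nonempty), I.card ≤ dmax ∧
    ∀ x ∈ cube d, f x = I.sup' hI fun i => x i

/-- `f ∈ G^H_d(dstar, β, r)`: on `[0,1]^d`, `f` depends on exactly `dstar` of its input
coordinates, through a function in the Hölder ball `B^β_r([0,1]^{dstar})`. -/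
def GH (d dstar : ℕ) (β r : ℝ) (f : (Fin d → ℝ) → ℝ) : Prop :=
  ∃ (I : Finset (Fin d)) (hI : I.card = dstar) (g : (Fin dstar → ℝ) → ℝ),
    MemHolderBall dstar β r g ∧
    ∀ x ∈ cube d, f x = g fun j => x ↑(I.orderIsoOfFin hI j)

/-- Iterated composition `h_{n-1} ∘ ⋯ ∘ h_1 ∘ h_0` of a chain of maps with varying
dimensions `D : ℕ → ℕ`. -/
def depChain (D : ℕ → ℕ) (h : ∀ i : ℕ, (Fin (D i) → ℝ) → (Fin (D (i + 1)) → ℝ)) :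
    (n : ℕ) → (Fin (D 0) → ℝ) → (Fin (D n) → ℝ)
  | 0 => fun x => x
  | (n + 1) => fun x => h n (depChain D h n x)

/-- `f ∈ G^CHOM_d(q, K, dmax, dstar, β, r)`: on `[0,1]^d`, `f` is a composition
`h_q ∘ ⋯ ∘ h_0` where `h_0 : [0,1]^d → [0,1]^K`, `h_i : [0,1]^K → [0,1]^K` for
`0 < i < q`, `h_q : [0,1]^{d or K} → ℝ`, and each coordinate function of each `h_i`
belongs to `G^H(dstar, β, r) ∪ G^M(dmax)`. -/
def GCHOM (q d dmax dstar K : ℕ) (β r : ℝ) (f : (Fin d → ℝ) → ℝ) : Prop :=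
  ∃ (D : ℕ → ℕ) (h : ∀ i : ℕ, (Fin (D i) → ℝ) → (Fin (D (i + 1)) → ℝ))
    (hD0 : D 0 = d) (hDq : D (q + 1) = 1),
    (∀ i : ℕ, 1 ≤ i → i ≤ q → D i = K) ∧
    (∀ i : ℕ, i ≤ q → ∀ j : Fin (D (i + 1)),
      GH (D i) dstar β r (fun x => h i x j) ∨ GM (D i) dmax (fun x => h i x j)) ∧
    (∀ i : ℕ, i < q → ∀ x ∈ cube (D i), h i x ∈ cube (D (i + 1))) ∧
    (∀ x ∈ cube d,
      f x = depChain D h (q + 1) (fun i => x (Fin.cast hD0 i)) (Fin.cast hDq.symm 0))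

/-- `f ∈ G^CH_d(q, K, dstar, β, r)`: as `G^CHOM`, but every coordinate function belongs
to `G^H(dstar, β, r)`. -/
def GCH (q d dstar K : ℕ) (β r : ℝ) (f : (Fin d → ℝ) → ℝ) : Prop :=
  ∃ (D : ℕ → ℕ) (h : ∀ i : ℕ, (Fin (D i) → ℝ) → (Fin (D (i + 1)) → ℝ))
    (hD0 : D 0 = d) (hDq : D (q + 1) = 1),
    (∀ i : ℕ, 1 ≤ i → i ≤ q → D i = K) ∧
    (∀ i : ℕ, i ≤ q → ∀ j : Fin (D (i + 1)), GH (D i) dstar β r (fun x => h i x j)) ∧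
    (∀ i : ℕ, i < q → ∀ x ∈ cube (D i), h i x ∈ cube (D (i + 1))) ∧
    (∀ x ∈ cube d,
      f x = depChain D h (q + 1) (fun i => x (Fin.cast hD0 i)) (Fin.cast hDq.symm 0))

/-- The sup-norm over the cube of the (componentwise) difference of two vector-valued
functions. -/
def supDiffVec (m k : ℕ) (g g' : (Fin m → ℝ) → (Fin k → ℝ)) : ℝ :=
  sSup {t | ∃ x ∈ cube m, ∃ j : Fin k, t = |g x j - g' x j|}

/-- The binary entropy function `H`. -/
def entH (t : ℝ) : ℝ :=
  if t = 0 ∨ t = 1 then 0 else t * Real.log (1 / t) + (1 - t) * Real.log (1 / (1 - t))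

/-- `sup { 1/(2(2 + e^t + e^{-t})) : min u v ≤ t ≤ max u v }`. -/
def wSup (u v : ℝ) : ℝ :=
  sSup {s | ∃ t ∈ Set.Icc (min u v) (max u v), s = 1 / (2 * (2 + Real.exp t + Real.exp (-t)))}

/-- The function `J` of Statement 19. -/
def Jfun (x y : ℝ) : ℝ :=
  (x + y) * Real.log (2 / (x + y)) + (2 - x - y) * Real.log (2 / (2 - x - y))
    - (x * Real.log (1 / x) + (1 - x) * Real.log (1 / (1 - x))
        + y * Real.log (1 / y) + (1 - y) * Real.log (1 / (1 - y)))

/-- The grid `G_{Q,d}` of points of `[0,1]^d` whose coordinates are odd multiples of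
`1/(2Q)`. -/
def oddGrid (d Qn : ℕ) : Set (Fin d → ℝ) :=
  {a | a ∈ cube d ∧ ∀ i, ∃ k : ℤ, Odd k ∧ a i = (k : ℝ) / (2 * (Qn : ℝ))}


/-! ### Part A: a framework for building networks layer by layer -/

/-- Hidden layers, with neurons indexed by natural numbers. -/
def hid (m : ℕ → ℕ) (W : ℕ → ℕ → ℕ → ℝ) (v : ℕ → ℕ → ℝ) : ℕ → ℝ → ℕ → ℝ
  | 0 => fun x _ => x
  | (k + 1) => fun x j => max (∑ i ∈ Finset.range (m k), W k j i * hid m W v k x i - v (k + 1) j) 0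

/-- number of nonzero entries of the `a × b` corner of `W`. -/
def nzM (a b : ℕ) (W : ℕ → ℕ → ℝ) : ℕ := Set.ncard {p : Fin a × Fin b | W p.1 p.2 ≠ 0}

/-- number of nonzero entries of the first `a` entries of `v`. -/
def nzV (a : ℕ) (v : ℕ → ℝ) : ℕ := Set.ncard {j : Fin a | v j ≠ 0}

lemma hid_congr {m m' : ℕ → ℕ} {W W' : ℕ → ℕ → ℕ → ℝ} {v v' : ℕ → ℕ → ℝ} {L : ℕ}
    (hm : ∀ k < L, m k = m' k) (hW : ∀ k < L, W k = W' k) (hv : ∀ k ≤ L, v k = v' k) :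
    hid m W v L = hid m' W' v' L := by
  induction L with
  | zero => rfl
  | succ L ih =>
    have := ih (fun k hk => hm k (by omega)) (fun k hk => hW k (by omega))
      (fun k hk => hv k (by omega))
    funext x j
    simp only [hid, this, hm L (by omega), hW L (by omega), hv (L + 1) le_rfl]

/-- The family `u` is computed by the `L`-th hidden layer of a network of width at most `N`
with at most `S` nonzero parameters. -/
def Reach (N : ℝ) (L S : ℕ) {ι : Type} [Fintype ι] (u : ι → ℝ → ℝ) : Prop :=
  ∃ (m : ℕ → ℕ) (W : ℕ → ℕ → ℕ → ℝ) (v : ℕ → ℕ → ℝ) (e : ι ≃ Fin (m L)),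
    m 0 = 1 ∧ (∀ k, 1 ≤ k → k ≤ L → (m k : ℝ) ≤ N) ∧
    ((∑ k ∈ Finset.range L, nzM (m (k + 1)) (m k) (W k)) +
      (∑ k ∈ Finset.Icc 1 L, nzV (m k) (v k)) ≤ S) ∧
    (∀ k i j, |W k i j| ≤ 1) ∧ (∀ k j, |v k j| ≤ 1) ∧
    (∀ i x, u i x = hid m W v L x (e i))

lemma reach_zero (N : ℝ) : Reach N 0 0 (fun (_ : Unit) x => x) := by
  refine ⟨fun _ => 1, fun _ _ _ => 0, fun _ _ => 0, Equiv.ofUnique _ _, rfl, ?_, ?_, ?_, ?_, ?_⟩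
  · intro k h1 h2; omega
  · simp
  · simp
  · simp
  · intro i x; rfl

lemma reach_step {N : ℝ} {L S : ℕ} {ι ι' : Type} [Fintype ι] [Fintype ι'] {u : ι → ℝ → ℝ}
    (hu : Reach N L S u) (w : ι' → ι → ℝ) (b : ι' → ℝ) (hw : ∀ j i, |w j i| ≤ 1)
    (hb : ∀ j, |b j| ≤ 1) (hN : (Fintype.card ι' : ℝ) ≤ N) (s : ℕ)
    (hs : Set.ncard {p : ι' × ι | w p.1 p.2 ≠ 0} ≤ s) :
    Reach N (L + 1) (S + s + Fintype.card ι')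
      (fun j x => max (∑ i, w j i * u i x - b j) 0) := by
  classical
  obtain ⟨m, W, v, e, h0, hmN, hS, hW, hv, hue⟩ := hu
  set c := Fintype.card ι' with hc
  let e' : ι' ≃ Fin c := Fintype.equivFin ι'
  let Wn : ℕ → ℕ → ℝ := fun j i =>
    if h : j < c ∧ i < m L then w (e'.symm ⟨j, h.1⟩) (e.symm ⟨i, h.2⟩) else 0
  let vn : ℕ → ℝ := fun j => if h : j < c then b (e'.symm ⟨j, h⟩) else 0
  let m' := Function.update m (L + 1) c
  let W' := Function.update W L Wn
  let v' := Function.update v (L + 1) vn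
  have hm'1 : m' (L + 1) = c := by simp [m']
  have hm'2 : ∀ k ≤ L, m' k = m k := fun k hk => by
    simp [m', Function.update_of_ne (show k ≠ L + 1 by omega)]
  have hW'1 : W' L = Wn := by simp [W']
  have hW'2 : ∀ k < L, W' k = W k := fun k hk => by
    simp [W', Function.update_of_ne (show k ≠ L by omega)]
  have hv'1 : v' (L + 1) = vn := by simp [v']
  have hv'2 : ∀ k ≤ L, v' k = v k := fun k hk => by
    simp [v', Function.update_of_ne (show k ≠ L + 1 by omega)]
  have hWn : ∀ (j : Fin c) (i : Fin (m L)), Wn j i = w (e'.symm j) (e.symm i) := by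
    intro j i
    simp [Wn]
  have hvn : ∀ (j : Fin c), vn j = b (e'.symm j) := by
    intro j
    simp [vn]
  refine ⟨m', W', v', e'.trans (finCongr hm'1.symm), ?_, ?_, ?_, ?_, ?_, ?_⟩
  · rw [hm'2 0 (by omega), h0]
  · intro k h1 h2
    rcases Nat.lt_or_ge L k with h | h
    · have : k = L + 1 := by omega
      subst this
      rw [hm'1]; exact hN
    · rw [hm'2 k h]; exact hmN k h1 h
  · rw [Finset.sum_range_succ, Finset.sum_Icc_succ_top (by omega)]
    have e1 : ∑ k ∈ Finset.range L, nzM (m' (k + 1)) (m' k) (W' k)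
        = ∑ k ∈ Finset.range L, nzM (m (k + 1)) (m k) (W k) := by
      refine Finset.sum_congr rfl fun k hk => ?_
      have := Finset.mem_range.1 hk
      rw [hm'2 (k + 1) (by omega), hm'2 k (by omega), hW'2 k this]
    have e2 : ∑ k ∈ Finset.Icc 1 L, nzV (m' k) (v' k)
        = ∑ k ∈ Finset.Icc 1 L, nzV (m k) (v k) := by
      refine Finset.sum_congr rfl fun k hk => ?_
      have := (Finset.mem_Icc.1 hk).2
      rw [hm'2 k this, hv'2 k this]
    rw [e1, e2, hm'1, hm'2 L le_rfl, hW'1, hv'1]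
    have e3 : nzM c (m L) Wn ≤ s := by
      refine le_trans ?_ hs
      unfold nzM
      refine Set.ncard_le_ncard_of_injOn (fun p => (e'.symm p.1, e.symm p.2)) ?_ ?_ (Set.toFinite _)
      · intro p hp
        simpa [hWn] using hp
      · intro p _ q _ h
        simpa [Prod.ext_iff] using h
    have e4 : nzV c vn ≤ c := by
      unfold nzV
      calc _ ≤ Set.ncard (Set.univ : Set (Fin c)) := Set.ncard_le_ncard (Set.subset_univ _)
        _ = c := by simp [Set.ncard_univ]
    omega
  · intro k i j
    by_cases h : k = L
    · subst h
      rw [hW'1]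
      simp only [Wn]
      split_ifs
      · exact hw _ _
      · simp
    · simp only [W', Function.update_of_ne h]; exact hW k i j
  · intro k j
    by_cases h : k = L + 1
    · subst h
      rw [hv'1]
      simp only [vn]
      split_ifs
      · exact hb _
      · simp
    · simp only [v', Function.update_of_ne h]; exact hv k j
  · intro j x
    have hh : hid m' W' v' L = hid m W v L :=
      hid_congr (fun k hk => hm'2 k hk.le) hW'2 hv'2
    simp only [hid, hh, hm'2 L le_rfl, hW'1, hv'1]
    have h1 : ((e'.trans (finCongr hm'1.symm) j : Fin (m' (L + 1))) : ℕ) = (e' j : Fin c) := by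
      simp
    rw [h1, hvn, Equiv.symm_apply_apply, Finset.sum_range]
    congr 2
    rw [← Equiv.sum_comp e]
    refine Finset.sum_congr rfl fun i _ => ?_
    rw [hWn, Equiv.symm_apply_apply, Equiv.symm_apply_apply, hue]

lemma fnnHidden_eq (m : ℕ → ℕ) (W : ℕ → ℕ → ℕ → ℝ) (v : ℕ → ℕ → ℝ) (x : ℝ) (k : ℕ)
    (j : Fin (m k)) :
    fnnHidden m (fun k => Matrix.of fun i j => W k i j) (fun k j => v k j) k (fun _ => x) j
      = hid m W v k x j := by
  induction k with
  | zero => rfl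
  | succ k ih =>
    simp only [fnnHidden, hid, Matrix.mulVec, dotProduct, Matrix.of_apply]
    rw [Finset.sum_range]
    simp only [ih]

lemma reach_finish {N G : ℝ} {L S : ℕ} {ι : Type} [Fintype ι] {u : ι → ℝ → ℝ}
    (hu : Reach N L S u) (hL : 1 ≤ L) (hG : (L : ℝ) ≤ G) (w : ι → ℝ) (hw : ∀ i, |w i| ≤ 1)
    {S' : ℝ} (hS' : ((S + Fintype.card ι : ℕ) : ℝ) ≤ S') :
    IsFNN 1 G N S' 1 ⊤ (fun x => ∑ i, w i * u i (x 0)) := by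
  classical
  obtain ⟨m, W, v, e, h0, hmN, hS, hW, hv, hue⟩ := hu
  let Wn : ℕ → ℕ → ℝ := fun _ i => if h : i < m L then w (e.symm ⟨i, h⟩) else 0
  let m' := Function.update m (L + 1) 1
  let W' := Function.update W L Wn
  have hm'1 : m' (L + 1) = 1 := by simp [m']
  have hm'2 : ∀ k ≤ L, m' k = m k := fun k hk => by
    simp [m', Function.update_of_ne (show k ≠ L + 1 by omega)]
  have hW'1 : W' L = Wn := by simp [W']
  have hW'2 : ∀ k < L, W' k = W k := fun k hk => by
    simp [W', Function.update_of_ne (show k ≠ L by omega)]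
  have hcard : m L = Fintype.card ι := by
    rw [Fintype.card_congr e, Fintype.card_fin]
  refine ⟨L, m', fun k => Matrix.of fun i j => W' k i j, fun k j => v k j,
    by rw [hm'2 0 (by omega), h0], hm'1, hL, hG, ?_, ?_, ?_, ?_, ?_, ?_⟩
  · intro k h1 h2
    rw [hm'2 k h2]; exact hmN k h1 h2
  · refine le_trans ?_ hS'
    have key : (∑ k ∈ Finset.range (L + 1), nzM (m' (k + 1)) (m' k) (W' k)) +
        (∑ k ∈ Finset.Icc 1 L, nzV (m' k) (v k)) ≤ S + Fintype.card ι := by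
      rw [Finset.sum_range_succ]
      have e1 : ∑ k ∈ Finset.range L, nzM (m' (k + 1)) (m' k) (W' k)
          = ∑ k ∈ Finset.range L, nzM (m (k + 1)) (m k) (W k) := by
        refine Finset.sum_congr rfl fun k hk => ?_
        have := Finset.mem_range.1 hk
        rw [hm'2 (k + 1) (by omega), hm'2 k (by omega), hW'2 k this]
      have e2 : ∑ k ∈ Finset.Icc 1 L, nzV (m' k) (v k)
          = ∑ k ∈ Finset.Icc 1 L, nzV (m k) (v k) := by
        refine Finset.sum_congr rfl fun k hk => ?_
        have := (Finset.mem_Icc.1 hk).2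
        rw [hm'2 k this]
      rw [e1, e2, hm'1, hm'2 L le_rfl]
      have e3 : nzM 1 (m L) (W' L) ≤ Fintype.card ι := by
        unfold nzM
        calc _ ≤ Set.ncard (Set.univ : Set (Fin 1 × Fin (m L))) :=
              Set.ncard_le_ncard (Set.subset_univ _)
          _ = _ := by simp [Set.ncard_univ, hcard]
      omega
    exact_mod_cast key
  · intro k hk i j
    simp only [Matrix.of_apply]
    by_cases h : k = L
    · subst h
      rw [hW'1]
      simp only [Wn]
      split_ifs
      · exact hw _
      · simp
    · simp only [W', Function.update_of_ne h]; exact hW k _ _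
  · intro k _ _ j
    exact hv k _
  · intro x _; exact le_top
  · intro x
    have hx : (fun i : Fin (m' 0) => x (Fin.cast (by rw [hm'2 0 (by omega), h0]) i))
        = fun _ => x 0 := by
      funext i
      congr 1
      exact Subsingleton.elim _ _
    rw [hx]
    simp only [Matrix.mulVec, dotProduct, Matrix.of_apply]
    simp only [fnnHidden_eq]
    have hh : hid m' W' v L = hid m W v L :=
      hid_congr (fun k hk => hm'2 k hk.le) hW'2 (fun _ _ => rfl)
    rw [hh]
    rw [Finset.sum_fin_eq_sum_range]
    rw [hm'2 L le_rfl, hW'1, Finset.sum_range, ← Equiv.sum_comp e]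
    refine Finset.sum_congr rfl fun i _ => ?_
    simp [Wn, hue]

/-- Block layers: blocks of three neurons, block `b` reads from block `π b`. -/
lemma reach_block {N : ℝ} {L S : ℕ} {κ κ' : Type} [Fintype κ] [Fintype κ']
    {u : κ × Fin 3 → ℝ → ℝ}
    (hu : Reach N L S u) (π : κ' → κ) (w : κ' → Fin 3 → Fin 3 → ℝ) (b : κ' → Fin 3 → ℝ)
    (hw : ∀ k j i, |w k j i| ≤ 1) (hb : ∀ k j, |b k j| ≤ 1)
    (hN : ((3 * Fintype.card κ' : ℕ) : ℝ) ≤ N) :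
    Reach N (L + 1) (S + 12 * Fintype.card κ')
      (fun (p : κ' × Fin 3) x => max (∑ i, w p.1 p.2 i * u (π p.1, i) x - b p.1 p.2) 0) := by
  classical
  have hc : Fintype.card (κ' × Fin 3) = 3 * Fintype.card κ' := by
    simp [mul_comm]
  have := reach_step hu (ι' := κ' × Fin 3)
    (fun p q => if π p.1 = q.1 then w p.1 p.2 q.2 else 0) (fun p => b p.1 p.2)
    (by
      intro p q
      split_ifs
      · exact hw _ _ _
      · simp) (fun p => hb _ _) (by rw [hc]; exact hN) (9 * Fintype.card κ') (by
      calc _ ≤ Set.ncard (Set.univ : Set ((κ' × Fin 3) × Fin 3)) := by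
            refine Set.ncard_le_ncard_of_injOn (fun p => (p.1, p.2.2)) (fun _ _ => Set.mem_univ _)
              ?_ (Set.toFinite _)
            rintro ⟨p, q1, q2⟩ hp ⟨p', q1', q2'⟩ hp' h
            simp only [Set.mem_ofPred_eq, ne_eq, ite_eq_right_iff, Classical.not_imp] at hp hp'
            simp only [Prod.mk.injEq] at h ⊢
            obtain ⟨rfl, rfl⟩ := h
            exact ⟨rfl, hp.1.symm.trans hp'.1, rfl⟩
        _ = _ := by
          rw [Set.ncard_univ, Nat.card_eq_fintype_card]
          simp
          ring)
  rw [hc] at this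
  convert this using 1
  · ring
  · funext p x
    rw [Fintype.sum_prod_type]
    congr 2
    rw [Finset.sum_eq_single (π p.1)]
    · simp
    · intro k _ hk
      simp [hk.symm]
    · simp

/-! ### Part B: block programs and the concrete network -/

/-- One layer of a block of three neurons. -/
def BStep (u u' : Fin 3 → ℝ → ℝ) : Prop :=
  ∃ (w : Fin 3 → Fin 3 → ℝ) (b : Fin 3 → ℝ), (∀ j i, |w j i| ≤ 1) ∧ (∀ j, |b j| ≤ 1) ∧
    ∀ j x, u' j x = max (∑ i, w j i * u i x - b j) 0

/-- Several layers of a block of three neurons. -/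
def BChain : ℕ → (Fin 3 → ℝ → ℝ) → (Fin 3 → ℝ → ℝ) → Prop
  | 0 => fun u u' => u = u'
  | (T + 1) => fun u u' => ∃ w, BChain T u w ∧ BStep w u'

lemma BChain.trans {a b : ℕ} {u v w : Fin 3 → ℝ → ℝ} (h1 : BChain a u v) (h2 : BChain b v w) :
    BChain (a + b) u w := by
  induction b generalizing w with
  | zero => cases h2; exact h1
  | succ b ih =>
    obtain ⟨w', h3, h4⟩ := h2
    exact ⟨w', ih h3, h4⟩

lemma BStep.chain {u v : Fin 3 → ℝ → ℝ} (h : BStep u v) : BChain 1 u v := ⟨u, rfl, h⟩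

lemma BStep.hold {u : Fin 3 → ℝ → ℝ} (h : ∀ j x, 0 ≤ u j x) : BStep u u := by
  refine ⟨fun j i => if j = i then 1 else 0, fun _ => 0, ?_, ?_, ?_⟩
  · intro j i; dsimp only; split_ifs <;> simp
  · simp
  · intro j x
    simp [h j x]

lemma BChain.hold {u : Fin 3 → ℝ → ℝ} (h : ∀ j x, 0 ≤ u j x) (T : ℕ) : BChain T u u := by
  induction T with
  | zero => rfl
  | succ T ih => exact ⟨u, ih, BStep.hold h⟩

lemma BStep.mk3 {u u' : Fin 3 → ℝ → ℝ} (w0 w1 w2 : Fin 3 → ℝ) (b : Fin 3 → ℝ)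
    (h0 : ∀ i, |w0 i| ≤ 1) (h1 : ∀ i, |w1 i| ≤ 1) (h2 : ∀ i, |w2 i| ≤ 1) (hb : ∀ i, |b i| ≤ 1)
    (e0 : ∀ x, u' 0 x = max (w0 0 * u 0 x + w0 1 * u 1 x + w0 2 * u 2 x - b 0) 0)
    (e1 : ∀ x, u' 1 x = max (w1 0 * u 0 x + w1 1 * u 1 x + w1 2 * u 2 x - b 1) 0)
    (e2 : ∀ x, u' 2 x = max (w2 0 * u 0 x + w2 1 * u 1 x + w2 2 * u 2 x - b 2) 0) :
    BStep u u' := by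
  refine ⟨![w0, w1, w2], b, ?_, hb, ?_⟩
  · intro j i
    fin_cases j
    · exact h0 i
    · exact h1 i
    · exact h2 i
  · intro j x
    rw [Fin.sum_univ_three]
    fin_cases j
    · exact e0 x
    · exact e1 x
    · exact e2 x

lemma reach_bstep {N : ℝ} {L S : ℕ} {κ κ' : Type} [Fintype κ] [Fintype κ']
    {u : κ × Fin 3 → ℝ → ℝ} {u' : κ' × Fin 3 → ℝ → ℝ}
    (hu : Reach N L S u) (π : κ' → κ)
    (hN : ((3 * Fintype.card κ' : ℕ) : ℝ) ≤ N)
    (h : ∀ k, BStep (fun i => u (π k, i)) (fun i => u' (k, i))) :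
    Reach N (L + 1) (S + 12 * Fintype.card κ') u' := by
  choose w b hw hb he using h
  have := reach_block hu π w b hw hb hN
  convert this using 1
  funext p x
  exact he p.1 p.2 x

lemma reach_chain {N : ℝ} {L S : ℕ} {κ : Type} [Fintype κ]
    {u u' : κ × Fin 3 → ℝ → ℝ}
    (hu : Reach N L S u) (hN : ((3 * Fintype.card κ : ℕ) : ℝ) ≤ N) (T : ℕ)
    (h : ∀ k, BChain T (fun i => u (k, i)) (fun i => u' (k, i))) :
    Reach N (L + T) (S + 12 * Fintype.card κ * T) u' := by
  induction T generalizing u' with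
  | zero =>
    have : u = u' := by
      funext ⟨k, i⟩ x
      exact congrFun (congrFun (h k) i) x
    subst this
    simpa using hu
  | succ T ih =>
    choose w h1 h2 using h
    have := reach_bstep (ih (u' := fun p => w p.1 p.2) h1) id hN (u' := u') h2
    convert this using 1 <;> ring

/-- scaled iterates of the tent map -/
def tau (y : ℝ) : ℕ → ℝ
  | 0 => y
  | (s + 1) => tau y s / 2 - max (tau y s - (1 / 2) * (1 / 4) ^ s) 0

/-- approximation of the square -/
def sqa (y : ℝ) : ℕ → ℝ
  | 0 => y
  | (s + 1) => sqa y s - tau y (s + 1)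

lemma tau_sqa {y : ℝ} (h0 : 0 ≤ y) (h1 : y ≤ 1) (s : ℕ) :
    0 ≤ tau y s ∧ tau y s ≤ (1 / 4) ^ s ∧
      sqa y s = y ^ 2 + tau y s - 4 ^ s * (tau y s) ^ 2 := by
  induction s with
  | zero => simp [tau, sqa, h0, h1]
  | succ s ih =>
    obtain ⟨ha, hb, hc⟩ := ih
    have hE : (4 : ℝ) ^ s * (1 / 4) ^ s = 1 := by
      rw [← mul_pow]; norm_num
    simp only [tau, sqa, hc, pow_succ (4 : ℝ), pow_succ (1 / 4 : ℝ)]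
    generalize tau y s = t at *
    generalize (4 : ℝ) ^ s = E at *
    generalize (1 / 4 : ℝ) ^ s = e at *
    rcases le_total t (1 / 2 * e) with h | h
    · rw [max_eq_right (by linarith)]
      refine ⟨by linarith, by linarith, by ring⟩
    · rw [max_eq_left (by linarith)]
      refine ⟨by linarith, by linarith, ?_⟩
      linear_combination (-2 * t + e) * hE

lemma sqa_bounds {y : ℝ} (h0 : 0 ≤ y) (h1 : y ≤ 1) (s : ℕ) :
    y ^ 2 ≤ sqa y s ∧ sqa y s ≤ y ^ 2 + (1 / 4) ^ s ∧ sqa y s ≤ 1 := by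
  obtain ⟨ha, hb, hc⟩ := tau_sqa h0 h1 s
  have hE : (4 : ℝ) ^ s * (1 / 4) ^ s = 1 := by
    rw [← mul_pow]; norm_num
  have hEp : (0 : ℝ) < 4 ^ s := by positivity
  have h3 : 4 ^ s * tau y s ≤ 1 := by rw [← hE]; gcongr
  have h2 : sqa y s ≤ y := by
    clear hc hb ha h3
    induction s with
    | zero => simp [sqa]
    | succ s ih =>
      have := (tau_sqa h0 h1 (s + 1)).1
      simp only [sqa]
      have := ih (by rw [← mul_pow]; norm_num) (by positivity)
      linarith
  refine ⟨?_, ?_, by linarith⟩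
  · rw [hc]; nlinarith
  · rw [hc]; nlinarith [mul_nonneg hEp.le (sq_nonneg (tau y s))]

lemma square_round (m : ℕ) (u : Fin 3 → ℝ → ℝ) (hu : ∀ x, 0 ≤ u 2 x ∧ u 2 x ≤ 1) :
    ∃ u' : Fin 3 → ℝ → ℝ, (∀ j x, 0 ≤ u' j x) ∧ (∀ x, u' 2 x = sqa (u 2 x) m) ∧
      BChain (m + 1) u u' := by
  suffices H : ∀ m, BChain (m + 1) u
      ![fun x => tau (u 2 x) m, fun x => max (tau (u 2 x) m - (1 / 2) * (1 / 4) ^ m) 0,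
        fun x => sqa (u 2 x) m] by
    refine ⟨_, ?_, fun x => ?_, H m⟩
    · intro j x
      fin_cases j
      · exact (tau_sqa (hu x).1 (hu x).2 m).1
      · exact le_max_right _ _
      · exact (sq_nonneg _).trans (sqa_bounds (hu x).1 (hu x).2 m).1
    · rfl
  intro m
  induction m with
  | zero =>
    refine ⟨u, rfl, BStep.mk3 ![0, 0, 1] ![0, 0, 1] ![0, 0, 1] ![0, 1 / 2, 0] ?_ ?_ ?_ ?_ ?_ ?_ ?_⟩
    · intro i; fin_cases i <;> simp
    · intro i; fin_cases i <;> simp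
    · intro i; fin_cases i <;> simp
    · intro i; fin_cases i <;> norm_num [abs_le]
    · intro x; simp [tau, hu x]
    · intro x; simp [tau]
    · intro x; simp [sqa, hu x]
  | succ m ih =>
    refine ⟨_, ih, BStep.mk3 ![1 / 2, -1, 0] ![1 / 2, -1, 0] ![-1 / 2, 1, 1]
      ![0, (1 / 2) * (1 / 4) ^ (m + 1), 0] ?_ ?_ ?_ ?_ ?_ ?_ ?_⟩
    · intro i; fin_cases i <;> norm_num [abs_le]
    · intro i; fin_cases i <;> norm_num [abs_le]
    · intro i; fin_cases i <;> norm_num [abs_le]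
    · intro i
      have h1 : (1 / 4 : ℝ) ^ (m + 1) ≤ 1 := pow_le_one₀ (by norm_num) (by norm_num)
      have h2 : (0 : ℝ) ≤ (1 / 4 : ℝ) ^ (m + 1) := by positivity
      fin_cases i
      · simp
      · show |(1 / 2 : ℝ) * (1 / 4) ^ (m + 1)| ≤ 1
        rw [abs_of_nonneg (by positivity)]; linarith
      · simp
    · intro x
      have := (tau_sqa (hu x).1 (hu x).2 (m + 1)).1
      show tau (u 2 x) (m + 1) = max ((1 / 2) * tau (u 2 x) m +
        (-1) * max (tau (u 2 x) m - (1 / 2) * (1 / 4) ^ m) 0 + 0 * sqa (u 2 x) m - 0) 0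
      rw [max_eq_left]
      · simp only [tau]; ring
      · simp only [tau] at this; linarith
    · intro x
      show max (tau (u 2 x) (m + 1) - (1 / 2) * (1 / 4) ^ (m + 1)) 0 = max ((1 / 2) * tau (u 2 x) m +
        (-1) * max (tau (u 2 x) m - (1 / 2) * (1 / 4) ^ m) 0 + 0 * sqa (u 2 x) m
          - (1 / 2) * (1 / 4) ^ (m + 1)) 0
      congr 1
      simp only [tau]; ring
    · intro x
      have := (sq_nonneg _).trans (sqa_bounds (hu x).1 (hu x).2 (m + 1)).1
      show sqa (u 2 x) (m + 1) = max ((-1 / 2) * tau (u 2 x) m +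
        1 * max (tau (u 2 x) m - (1 / 2) * (1 / 4) ^ m) 0 + 1 * sqa (u 2 x) m - 0) 0
      rw [max_eq_left]
      · simp only [tau, sqa]; ring
      · simp only [tau, sqa] at this; linarith

/-- approximation of `y ^ (2 ^ i)` -/
def SQ (m : ℕ) : ℕ → ℝ → ℝ
  | 0 => fun y => y
  | (i + 1) => fun y => sqa (SQ m i y) m

lemma SQ_bounds (m i : ℕ) {y : ℝ} (h0 : 0 ≤ y) (h1 : y ≤ 1) : 0 ≤ SQ m i y ∧ SQ m i y ≤ 1 := by
  induction i with
  | zero => exact ⟨h0, h1⟩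
  | succ i ih =>
    have := sqa_bounds ih.1 ih.2 m
    exact ⟨(sq_nonneg _).trans this.1, this.2.2⟩

lemma square_rounds (m i : ℕ) (u : Fin 3 → ℝ → ℝ) (hpos : ∀ j x, 0 ≤ u j x)
    (hu : ∀ x, u 2 x ≤ 1) :
    ∃ u' : Fin 3 → ℝ → ℝ, (∀ j x, 0 ≤ u' j x) ∧ (∀ x, u' 2 x = SQ m i (u 2 x)) ∧
      BChain (i * (m + 1)) u u' := by
  induction i with
  | zero => exact ⟨u, hpos, fun x => rfl, by rw [zero_mul]; rfl⟩
  | succ i ih =>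
    obtain ⟨v, hv0, hv, hc⟩ := ih
    obtain ⟨u', h0, h1, h2⟩ := square_round m v (fun x => by
      rw [hv]; exact SQ_bounds m i (hpos _ _) (hu x))
    refine ⟨u', h0, fun x => ?_, ?_⟩
    · rw [h1, hv]; rfl
    · rw [Nat.succ_mul]; exact hc.trans h2

lemma square_rounds_hold (m i p : ℕ) (hi : i ≤ p) (u : Fin 3 → ℝ → ℝ) (hpos : ∀ j x, 0 ≤ u j x)
    (hu : ∀ x, u 2 x ≤ 1) :
    ∃ u' : Fin 3 → ℝ → ℝ, (∀ x, u' 2 x = SQ m i (u 2 x)) ∧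
      BChain (p * (m + 1)) u u' := by
  obtain ⟨u', h0, h1, h2⟩ := square_rounds m i u hpos hu
  refine ⟨u', h1, ?_⟩
  have := h2.trans (BChain.hold h0 ((p - i) * (m + 1)))
  rwa [← add_mul, Nat.add_sub_cancel' hi] at this

lemma double_chain (x0 : ℝ → ℝ) (hx : ∀ x, 0 ≤ x0 x) (k : ℕ) :
    BChain k ![x0, x0, fun _ => 0]
      ![fun x => 2 ^ k * x0 x, fun x => 2 ^ k * x0 x, fun _ => 0] := by
  induction k with
  | zero => simp [BChain]
  | succ k ih =>
    refine ⟨_, ih, BStep.mk3 ![1, 1, 0] ![1, 1, 0] ![0, 0, 0] ![0, 0, 0] ?_ ?_ ?_ ?_ ?_ ?_ ?_⟩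
    · intro i; fin_cases i <;> simp
    · intro i; fin_cases i <;> simp
    · intro i; fin_cases i <;> simp
    · intro i; fin_cases i <;> simp
    · intro x
      show (2 : ℝ) ^ (k + 1) * x0 x = max (1 * (2 ^ k * x0 x) + 1 * (2 ^ k * x0 x) + 0 * 0 - 0) 0
      rw [max_eq_left (by have := mul_nonneg (pow_nonneg (zero_le_two (α := ℝ)) k) (hx x); linarith)]; ring
    · intro x
      show (2 : ℝ) ^ (k + 1) * x0 x = max (1 * (2 ^ k * x0 x) + 1 * (2 ^ k * x0 x) + 0 * 0 - 0) 0
      rw [max_eq_left (by have := mul_nonneg (pow_nonneg (zero_le_two (α := ℝ)) k) (hx x); linarith)]; ring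
    · intro x; simp

lemma double_hold (x0 : ℝ → ℝ) (hx : ∀ x, 0 ≤ x0 x) (k n : ℕ) (hk : k ≤ n) :
    BChain n ![x0, x0, fun _ => 0]
      ![fun x => 2 ^ k * x0 x, fun x => 2 ^ k * x0 x, fun _ => 0] := by
  have := (double_chain x0 hx k).trans (BChain.hold (T := n - k) ?_)
  · rwa [Nat.add_sub_cancel' hk] at this
  · intro j x
    have := hx x
    fin_cases j
    · show 0 ≤ (2 : ℝ) ^ k * x0 x
      positivity
    · show 0 ≤ (2 : ℝ) ^ k * x0 x
      positivity
    · simp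

/-- clipping to `[q, 1]` -/
def clp (q y : ℝ) : ℝ := q + max (y - q) 0 - max (y - 1) 0

lemma clp_eq {q y : ℝ} (hq : q ≤ 1) : clp q y = max q (min y 1) := by
  unfold clp
  rcases le_total y q with h | h
  · rw [max_eq_right (by linarith), max_eq_right (by linarith : y - 1 ≤ 0), min_eq_left (by linarith),
      max_eq_left h]; ring
  · rw [max_eq_left (by linarith)]
    rcases le_total y 1 with h' | h'
    · rw [max_eq_right (by linarith), min_eq_left h', max_eq_right h]; ring
    · rw [max_eq_left (by linarith), min_eq_right h', max_eq_right hq]; ring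

lemma clp_bounds {q y : ℝ} (hq : q ≤ 1) : q ≤ clp q y ∧ clp q y ≤ 1 := by
  rw [clp_eq hq]
  exact ⟨le_max_left _ _, max_le hq (min_le_right _ _)⟩

/-- The whole network. -/
lemma network {N G S' : ℝ} (n M p m C : ℕ) (hn : 1 ≤ n) (hM : 1 ≤ M) (hC : 1 ≤ C)
    (g : Fin (p + 1) → ℝ) (hg : ∀ i, |g i| ≤ C) (r : ℝ) (hr1 : 1 ≤ r) (hrM : r ^ M = 2)
    (q : ℝ) (hq0 : 0 ≤ q) (hq1 : q ≤ 1)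
    (lo hi : ℝ) (hlo : 0 ≤ lo) (hlh : lo ≤ hi) (hhi : hi ≤ n)
    (hN : ((3 * (n * M * ((p + 1) * C)) : ℕ) : ℝ) ≤ N)
    (hG : ((n + p * (m + 1) + 5 : ℕ) : ℝ) ≤ G)
    (hS : ((18 * n ^ 2 + n * M * ((p + 1) * C) * (12 * p * (m + 1) + 51) : ℕ) : ℝ) ≤ S') :
    IsFNN 1 G N S' 1 ⊤ (fun x =>
      - lo - max ((∑ J : Fin (n * M), ∑ i : Fin (p + 1),
          g i * (1 - SQ m i (clp q (r ^ (J : ℕ) * max (x 0) 0)))) - lo) 0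
        + max ((∑ J : Fin (n * M), ∑ i : Fin (p + 1),
          g i * (1 - SQ m i (clp q (r ^ (J : ℕ) * max (x 0) 0)))) - hi) 0) := by
  set K := n * M * ((p + 1) * C) with hK
  have hnK : n ≤ K := by
    rw [hK, mul_assoc]
    exact Nat.le_mul_of_pos_right _ (by positivity)
  have hNn : ((3 * n : ℕ) : ℝ) ≤ N := le_trans (by exact_mod_cast Nat.mul_le_mul_left 3 hnK) hN
  -- first layer
  have R1 : Reach N 1 (6 * n) (fun (z : Fin n × Fin 3) x =>
      ![fun x => max x 0, fun x => max x 0, fun _ => (0 : ℝ)] z.2 x) := by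
    have := reach_step (reach_zero N) (ι' := Fin n × Fin 3) (fun z _ => ![1, 1, 0] z.2)
      (fun _ => 0) ?_ (by simp) ?_ (3 * n) ?_
    · convert this using 1
      · simp; ring
      · funext z x
        obtain ⟨a, j⟩ := z
        fin_cases j <;> simp
    · rintro ⟨a, j⟩ _
      fin_cases j <;> simp
    · refine le_trans (le_of_eq ?_) hNn
      simp; ring
    · calc _ ≤ Set.ncard (Set.univ : Set ((Fin n × Fin 3) × Unit)) :=
            Set.ncard_le_ncard (Set.subset_univ _)
        _ = _ := by simp [Set.ncard_univ]; ring
  -- doublings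
  have R2 := reach_chain R1 (by simpa using hNn) n
    (u' := fun (z : Fin n × Fin 3) => ![fun x => 2 ^ (z.1 : ℕ) * max x 0, fun x => 2 ^ (z.1 : ℕ) * max x 0,
      fun _ => (0 : ℝ)] z.2)
    (fun k => double_hold (fun x => max x 0) (fun x => le_max_right _ _) k n k.2.le)
  -- expansion and clipping
  have hcard : Fintype.card (Fin (n * M) × Fin (p + 1) × Fin C) = K := by
    simp [hK]
  have hNK : ((3 * Fintype.card (Fin (n * M) × Fin (p + 1) × Fin C) : ℕ) : ℝ) ≤ N := by
    rw [hcard]; exact hN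
  have hr2 : ∀ J : ℕ, r ^ (J % M) ≤ 2 := fun J => by
    rw [← hrM]; exact pow_le_pow_right₀ hr1 (Nat.mod_lt _ hM).le
  have R3 := reach_bstep R2 (κ' := Fin (n * M) × Fin (p + 1) × Fin C)
    (fun k => ⟨(k.1 : ℕ) / M, Nat.div_lt_of_lt_mul (lt_of_lt_of_eq k.1.2 (mul_comm n M))⟩) hNK
    (u' := fun z => ![fun x => max (r ^ (z.1.1 : ℕ) * max x 0 - q) 0,
      fun x => max (r ^ (z.1.1 : ℕ) * max x 0 - 1) 0, fun _ => (0 : ℝ)] z.2) (fun k => by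
      have h1 : |r ^ ((k.1 : ℕ) % M) / 2| ≤ 1 := by
        rw [abs_of_nonneg (by positivity)]
        linarith [hr2 k.1]
      have h2 : r ^ (k.1 : ℕ) = 2 ^ ((k.1 : ℕ) / M) * r ^ ((k.1 : ℕ) % M) := by
        rw [← hrM, ← pow_mul, ← pow_add, Nat.div_add_mod]
      refine BStep.mk3 ![r ^ ((k.1 : ℕ) % M) / 2, r ^ ((k.1 : ℕ) % M) / 2, 0]
        ![r ^ ((k.1 : ℕ) % M) / 2, r ^ ((k.1 : ℕ) % M) / 2, 0] ![0, 0, 0] ![q, 1, 0] ?_ ?_ ?_ ?_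
        ?_ ?_ ?_
      · intro i; fin_cases i
        · exact h1
        · exact h1
        · simp
      · intro i; fin_cases i
        · exact h1
        · exact h1
        · simp
      · intro i; fin_cases i <;> simp
      · intro i; fin_cases i <;> simp [abs_of_nonneg hq0, hq1]
      · intro x
        simp [h2]; ring_nf
      · intro x
        simp [h2]; ring_nf
      · intro x
        simp)
  have R4 := reach_bstep R3 (κ' := Fin (n * M) × Fin (p + 1) × Fin C) id hNK
    (u' := fun z => ![fun _ => (0 : ℝ), fun _ => (0 : ℝ),
      fun x => clp q (r ^ (z.1.1 : ℕ) * max x 0)] z.2) (fun k => by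
      refine BStep.mk3 ![0, 0, 0] ![0, 0, 0] ![1, -1, 0] ![0, 0, -q] ?_ ?_ ?_ ?_
        ?_ ?_ ?_
      · intro i; fin_cases i <;> simp
      · intro i; fin_cases i <;> simp
      · intro i; fin_cases i <;> simp
      · intro i; fin_cases i <;> simp [abs_of_nonneg hq0, hq1]
      · intro x; simp
      · intro x; simp
      · intro x
        have h1 := hq0.trans (clp_bounds (y := r ^ (k.1 : ℕ) * max x 0) hq1).1
        show clp q (r ^ (k.1 : ℕ) * max x 0) = max (1 * max (r ^ (k.1 : ℕ) * max x 0 - q) 0 +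
          (-1) * max (r ^ (k.1 : ℕ) * max x 0 - 1) 0 + 0 * 0 - (-q)) 0
        unfold clp at h1 ⊢
        rw [max_eq_left (by linarith : 0 ≤ 1 * max (r ^ (k.1 : ℕ) * max x 0 - q) 0 +
          (-1) * max (r ^ (k.1 : ℕ) * max x 0 - 1) 0 + 0 * 0 - (-q))]
        ring)
  have ex : ∀ k : Fin (n * M) × Fin (p + 1) × Fin C, ∃ u' : Fin 3 → ℝ → ℝ,
      (∀ x, u' 2 x = SQ m k.2.1 (clp q (r ^ (k.1 : ℕ) * max x 0))) ∧
      BChain (p * (m + 1)) ![fun _ => (0 : ℝ), fun _ => (0 : ℝ),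
        fun x => clp q (r ^ (k.1 : ℕ) * max x 0)] u' := by
    intro k
    refine square_rounds_hold m k.2.1 p (by omega) ![fun _ => (0 : ℝ), fun _ => (0 : ℝ),
        fun x => clp q (r ^ (k.1 : ℕ) * max x 0)] ?_ ?_
    · intro j x
      fin_cases j
      · simp
      · simp
      · exact hq0.trans (clp_bounds hq1).1
    · intro x
      exact (clp_bounds hq1).2
  choose U hU1 hU2 using ex
  have R5 := reach_chain R4 hNK (p * (m + 1)) (u' := fun z => U z.1 z.2) hU2
  have R6 := reach_bstep R5 (κ' := Fin (n * M) × Fin (p + 1) × Fin C) id hNK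
    (u' := fun z => ![fun x => 1 - SQ m z.1.2.1 (clp q (r ^ (z.1.1 : ℕ) * max x 0)), fun _ => (1 : ℝ),
      fun _ => (0 : ℝ)] z.2) (fun k => by
      refine BStep.mk3 ![0, 0, -1] ![0, 0, 0] ![0, 0, 0] ![-1, -1, 0] ?_ ?_ ?_ ?_
        ?_ ?_ ?_
      · intro i; fin_cases i <;> simp
      · intro i; fin_cases i <;> simp
      · intro i; fin_cases i <;> simp
      · intro i; fin_cases i <;> simp
      · intro x
        have h1 := clp_bounds (y := r ^ (k.1 : ℕ) * max x 0) hq1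
        have h2 := SQ_bounds m k.2.1 (hq0.trans h1.1) h1.2
        have h3 := hU1 k x
        simp [h3, h2]
        ring
      · intro x; simp
      · intro x; simp)
  have hKpos : (0 : ℝ) < K := by exact_mod_cast lt_of_lt_of_le hn hnK
  have hnK' : (n : ℝ) ≤ K := by exact_mod_cast hnK
  have hClo : |lo / K| ≤ 1 := by
    rw [abs_of_nonneg (by positivity), div_le_one hKpos]; linarith
  have hChi : |hi / K| ≤ 1 := by
    rw [abs_of_nonneg (by have := hlo.trans hlh; positivity), div_le_one hKpos]; linarith
  have hCpos : (0 : ℝ) < C := by exact_mod_cast hC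
  have hgC : ∀ i, |g i / C| ≤ 1 := fun i => by
    rw [abs_div, abs_of_pos hCpos, div_le_one hCpos]; exact hg i
  have R7 := reach_step R6 (ι' := Fin 3)
    (fun j z => ![![0, lo / K, 0], ![g z.1.2.1 / C, - (lo / K), 0], ![g z.1.2.1 / C, - (hi / K), 0]] j z.2)
    (fun _ => 0) (by
      rintro j ⟨k, i⟩
      fin_cases j <;> fin_cases i <;> simp [hClo, hChi, hgC, abs_neg]) (by simp)
      (by
        refine le_trans ?_ hNn
        simp
        have : (1 : ℝ) ≤ n := by exact_mod_cast hn
        linarith) (9 * K) (by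
      calc _ ≤ Set.ncard (Set.univ : Set (Fin 3 × (Fin (n * M) × Fin (p + 1) × Fin C) × Fin 3)) :=
            Set.ncard_le_ncard (Set.subset_univ _)
        _ = _ := by simp [Set.ncard_univ, hK]; ring)
  have := reach_finish R7 (by omega) (G := G) (S' := S') (le_trans (le_of_eq (by push_cast; ring)) hG)
    ![-1, -1, 1] (by intro i; fin_cases i <;> simp) (by
      refine le_trans ?_ hS
      rw [hcard]
      simp only [Fintype.card_fin]
      have h1 : 1 ≤ K := hn.trans hnK
      have h2 : n ≤ n ^ 2 := by nlinarith
      norm_cast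
      nlinarith)
  have hsum : ∀ (x c : ℝ), ∑ i : (Fin (n * M) × Fin (p + 1) × Fin C) × Fin 3,
      (![g i.1.2.1 / C, c / K, 0] : Fin 3 → ℝ) i.2 *
      (![fun x => 1 - SQ m i.1.2.1 (clp q (r ^ (i.1.1 : ℕ) * max x 0)), fun _ => (1 : ℝ),
      fun _ => (0 : ℝ)] : Fin 3 → ℝ → ℝ) i.2 x = (∑ J : Fin (n * M), ∑ i : Fin (p + 1),
          g i * (1 - SQ m i (clp q (r ^ (J : ℕ) * max x 0)))) + c := by
    intro x c
    rw [Fintype.sum_prod_type]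
    simp only [Fin.sum_univ_three]
    simp [Finset.sum_add_distrib]
    congr 1
    · simp only [Fintype.sum_prod_type]
      refine Finset.sum_congr rfl fun J _ => Finset.sum_congr rfl fun i _ => ?_
      simp
      field_simp
    · rw [hK]
      push_cast
      have : (n : ℝ) ≠ 0 := by positivity
      have : (M : ℝ) ≠ 0 := by positivity
      field_simp
  convert this using 1
  funext x
  rw [Fin.sum_univ_three]
  have h1 := hsum (x 0) (-lo)
  have h2 := hsum (x 0) (-hi)
  have h0 : ∑ i : (Fin (n * M) × Fin (p + 1) × Fin C) × Fin 3,
      (![0, lo / K, 0] : Fin 3 → ℝ) i.2 *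
      (![fun x => 1 - SQ m i.1.2.1 (clp q (r ^ (i.1.1 : ℕ) * max x 0)), fun _ => (1 : ℝ),
      fun _ => (0 : ℝ)] : Fin 3 → ℝ → ℝ) i.2 (x 0) = lo := by
    rw [Fintype.sum_prod_type]
    simp only [Fin.sum_univ_three]
    simp
    rw [hK]
    push_cast
    have : (n : ℝ) ≠ 0 := by positivity
    have : (M : ℝ) ≠ 0 := by positivity
    field_simp
  simp only [neg_div] at h1 h2
  simp only [Matrix.cons_val_zero, Matrix.cons_val_one, Matrix.cons_val, h0, h1, h2]
  rw [sub_zero, sub_zero, sub_zero, max_eq_left hlo]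
  ring_nf

/-! ### Part C: analysis -/

lemma coeffs (p : ℕ) : ∃ c : Fin (p + 1) → ℝ, ∀ j, 1 ≤ j → j ≤ p + 1 →
    ∑ i, c i * ((2 : ℝ) ^ (i : ℕ)) ^ j = if j = 1 then 1 else 0 := by
  classical
  let v : Fin (p + 1) → ℝ := fun i => 2 ^ (i : ℕ)
  have hv : Function.Injective v := by
    intro i j h
    have : (i : ℕ) = j := pow_right_injective₀ (by norm_num) (by norm_num) h
    exact Fin.ext this
  refine ⟨fun i => (Lagrange.basis Finset.univ v i).eval 0 / v i, fun j h1 h2 => ?_⟩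
  obtain ⟨k, rfl⟩ : ∃ k, j = k + 1 := ⟨j - 1, by omega⟩
  have h := Lagrange.eq_interpolate (s := Finset.univ) (v := v) (f := (Polynomial.X ^ k : Polynomial ℝ))
    hv.injOn (by
      rw [Polynomial.degree_X_pow, Finset.card_univ, Fintype.card_fin]
      exact_mod_cast h2)
  have h' := congrArg (Polynomial.eval 0) h
  rw [Lagrange.interpolate_apply, Polynomial.eval_finsetSum] at h'
  simp only [Polynomial.eval_pow, Polynomial.eval_X, Polynomial.eval_mul, Polynomial.eval_C] at h'
  have e : ∀ i : Fin (p + 1), (Lagrange.basis Finset.univ v i).eval 0 / v i * ((2 : ℝ) ^ (i : ℕ)) ^ (k + 1)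
      = v i ^ k * (Lagrange.basis Finset.univ v i).eval 0 := by
    intro i
    have : v i ≠ 0 := by simp [v]
    show _ / v i * (v i) ^ (k + 1) = _
    field_simp
    ring
  rw [Finset.sum_congr rfl fun i _ => e i, ← h', zero_pow_eq]
  simp

lemma exp_rem (n : ℕ) (x : ℝ) :
    |Real.exp x - ∑ j ∈ Finset.range n, x ^ j / (j.factorial : ℝ)| ≤ |x| ^ n * Real.exp |x| := by
  have := Complex.norm_exp_sub_sum_le_norm_mul_exp (x : ℂ) n
  rw [← Real.norm_eq_abs, ← Real.norm_eq_abs x, ← Complex.norm_real, ← Complex.norm_real x]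
  push_cast
  exact this

lemma log_expansion (p : ℕ) : ∃ (c : Fin (p + 1) → ℝ) (C₁ : ℝ), 1 ≤ C₁ ∧
    ∀ t : ℝ, 0 ≤ t → t ≤ 1 →
      |∑ i, c i * (1 - Real.exp (-(2 ^ (i : ℕ) * t))) - t| ≤ C₁ * t ^ (p + 2) := by
  obtain ⟨c, hc⟩ := coeffs p
  refine ⟨c, 1 + ∑ i, |c i| * ((2 ^ (i : ℕ)) ^ (p + 2) * Real.exp (2 ^ (i : ℕ))), ?_, ?_⟩
  · have : 0 ≤ ∑ i, |c i| * (((2 : ℝ) ^ (i : ℕ)) ^ (p + 2) * Real.exp (2 ^ (i : ℕ))) := by positivity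
    linarith
  · intro t h0 h1
    have main : ∑ i, c i * (1 - ∑ j ∈ Finset.range (p + 2),
        (-(2 ^ (i : ℕ) * t)) ^ j / (j.factorial : ℝ)) = t := by
      have : ∀ i : Fin (p + 1), c i * (1 - ∑ j ∈ Finset.range (p + 2),
        (-(2 ^ (i : ℕ) * t)) ^ j / (j.factorial : ℝ)) = ∑ j ∈ Finset.range (p + 1),
          (c i * ((2 : ℝ) ^ (i : ℕ)) ^ (j + 1)) * (- ((-t) ^ (j + 1) / ((j + 1).factorial : ℝ))) := by
        intro i
        rw [Finset.sum_range_succ']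
        simp only [pow_zero, Nat.factorial_zero, Nat.cast_one, div_one]
        rw [sub_add_cancel_right, mul_neg, Finset.mul_sum, ← Finset.sum_neg_distrib]
        refine Finset.sum_congr rfl fun j _ => ?_
        rw [← mul_neg (_ ^ _) t, mul_pow]
        ring
      rw [Finset.sum_congr rfl fun i _ => this i, Finset.sum_comm]
      simp only [← Finset.sum_mul]
      rw [Finset.sum_range_succ', Finset.sum_eq_zero, hc 1 le_rfl (by omega)]
      · simp
      · intro j hj
        have := Finset.mem_range.1 hj
        rw [hc (j + 1 + 1) (by omega) (by omega)]
        simp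
    have e : ∑ i, c i * (1 - Real.exp (-(2 ^ (i : ℕ) * t))) - t
        = - ∑ i, c i * (Real.exp (-(2 ^ (i : ℕ) * t)) - ∑ j ∈ Finset.range (p + 2),
          (-(2 ^ (i : ℕ) * t)) ^ j / (j.factorial : ℝ)) := by
      conv_lhs => rw [← main]
      rw [← Finset.sum_sub_distrib, ← Finset.sum_neg_distrib]
      refine Finset.sum_congr rfl fun i _ => ?_
      rw [main]
      ring
    rw [e, abs_neg]
    refine (Finset.abs_sum_le_sum_abs _ _).trans ?_
    rw [add_mul, Finset.sum_mul]
    refine le_trans (Finset.sum_le_sum fun i _ => ?_) (le_add_of_nonneg_left (by positivity))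
    rw [abs_mul, mul_assoc]
    refine mul_le_mul_of_nonneg_left ((exp_rem _ _).trans ?_) (abs_nonneg _)
    rw [abs_neg, abs_of_nonneg (by positivity), mul_pow]
    have : Real.exp (2 ^ (i : ℕ) * t) ≤ Real.exp (2 ^ (i : ℕ)) :=
      Real.exp_le_exp.2 (mul_le_of_le_one_right (by positivity) h1)
    calc _ ≤ ((2 : ℝ) ^ (i : ℕ)) ^ (p + 2) * t ^ (p + 2) * Real.exp (2 ^ (i : ℕ)) := by gcongr
      _ = _ := by ring

lemma SQ_err (m i : ℕ) {y : ℝ} (h0 : 0 ≤ y) (h1 : y ≤ 1) :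
    |SQ m i y - y ^ (2 ^ i)| ≤ (2 ^ i - 1) * (1 / 4) ^ m := by
  induction i with
  | zero => simp [SQ]
  | succ i ih =>
    obtain ⟨hb0, hb1⟩ := SQ_bounds m i h0 h1
    have hs := sqa_bounds hb0 hb1 m
    have hy0 : 0 ≤ y ^ (2 ^ i) := by positivity
    have hy1 : y ^ (2 ^ i) ≤ 1 := pow_le_one₀ h0 h1
    have e1 : |sqa (SQ m i y) m - SQ m i y ^ 2| ≤ (1 / 4) ^ m := by
      rw [abs_le]; constructor <;> linarith [hs.1, hs.2.1, pow_nonneg (show (0 : ℝ) ≤ 1 / 4 by norm_num) m]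
    have e2 : |SQ m i y ^ 2 - (y ^ (2 ^ i)) ^ 2| ≤ 2 * |SQ m i y - y ^ (2 ^ i)| := by
      rw [sq_sub_sq, abs_mul]
      gcongr
      rw [abs_of_nonneg (by linarith)]
      linarith
    have e3 : y ^ (2 ^ (i + 1)) = (y ^ (2 ^ i)) ^ 2 := by rw [← pow_mul, pow_succ]
    simp only [SQ]
    rw [e3]
    calc _ ≤ |sqa (SQ m i y) m - SQ m i y ^ 2| + |SQ m i y ^ 2 - (y ^ (2 ^ i)) ^ 2| :=
          abs_sub_le _ _ _
      _ ≤ (1 / 4) ^ m + 2 * ((2 ^ i - 1) * (1 / 4) ^ m) := by linarith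
      _ = _ := by ring

lemma SQ_lip (m i : ℕ) {y : ℝ} (h0 : 0 ≤ y) (h1 : y ≤ 1) :
    1 - SQ m i y ≤ 2 ^ i * (1 - y) := by
  induction i with
  | zero => simp [SQ]
  | succ i ih =>
    obtain ⟨hb0, hb1⟩ := SQ_bounds m i h0 h1
    have hs := sqa_bounds hb0 hb1 m
    simp only [SQ]
    rw [pow_succ]
    nlinarith [hs.1]

lemma SQ_one (m i : ℕ) : SQ m i 1 = 1 := by
  have h1 := SQ_lip m i (y := 1) (by norm_num) le_rfl
  have h2 := SQ_bounds m i (y := 1) (by norm_num) le_rfl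
  simp at h1
  linarith

lemma clp_le {q y : ℝ} (hq : q ≤ 1) (h : y ≤ q) : clp q y = q := by
  rw [clp_eq hq, min_eq_left (h.trans hq), max_eq_left h]

lemma clp_ge {q y : ℝ} (hq : q ≤ 1) (h : 1 ≤ y) : clp q y = 1 := by
  rw [clp_eq hq, min_eq_right h, max_eq_right hq]

lemma clp_mid {q y : ℝ} (hq : q ≤ 1) (h : q ≤ y) (h' : y ≤ 1) : clp q y = y := by
  rw [clp_eq hq, min_eq_left h', max_eq_right h]

lemma sum_log_clp {r z : ℝ} (hr : 1 < r) (hz : 0 < z) (hz1 : z ≤ 1) (N : ℕ) :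
    ∑ J ∈ Finset.range N, Real.log (clp r⁻¹ (r ^ J * z)) = max (Real.log z) (-(N * Real.log r)) := by
  have hr0 : 0 < r := by linarith
  have hq : r⁻¹ ≤ 1 := inv_le_one_of_one_le₀ hr.le
  have hl : 0 < Real.log r := Real.log_pos hr
  induction N with
  | zero => simp [Real.log_nonpos hz.le hz1]
  | succ N ih =>
    rw [Finset.sum_range_succ, ih]
    push_cast
    have hlog : Real.log (r ^ N * z) = N * Real.log r + Real.log z := by
      rw [Real.log_mul (by positivity) (by positivity), Real.log_pow]
    have hpos : 0 < r ^ N * z := by positivity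
    rcases le_total 1 (r ^ N * z) with h | h
    · rw [clp_ge hq h, Real.log_one]
      have := Real.log_nonneg h
      rw [max_eq_left (by linarith), max_eq_left (by linarith)]
      ring
    · have h2 := Real.log_nonpos hpos.le h
      rcases le_total (r ^ N * z) r⁻¹ with h' | h'
      · rw [clp_le hq h', Real.log_inv]
        have := Real.log_le_log hpos h'
        rw [Real.log_inv] at this
        rw [max_eq_right (by linarith), max_eq_right (by linarith)]
        ring
      · rw [clp_mid hq h' h, hlog]
        have := Real.log_le_log (by positivity) h'
        rw [Real.log_inv] at this
        rw [max_eq_right (by linarith), max_eq_left (by linarith)]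
        ring

lemma sum_err {r z δ : ℝ} (hr : 1 < r) (hz : 0 < z) (E : ℝ → ℝ) (hE1 : E 1 = 0)
    (hEq : E r⁻¹ = 0) (hδ : 0 ≤ δ) (hE : ∀ y, r⁻¹ ≤ y → y ≤ 1 → |E y| ≤ δ) (N : ℕ) :
    |∑ J ∈ Finset.range N, E (clp r⁻¹ (r ^ J * z))| ≤ δ := by
  have hr0 : 0 < r := by linarith
  have hq : r⁻¹ ≤ 1 := inv_le_one_of_one_le₀ hr.le
  have key : ∀ J J', J < J' → E (clp r⁻¹ (r ^ J' * z)) ≠ 0 → E (clp r⁻¹ (r ^ J * z)) = 0 := by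
    intro J J' hJ h
    have h1 : r ^ J' * z < 1 := by
      by_contra h2
      rw [clp_ge hq (not_lt.1 h2)] at h
      exact h hE1
    rw [clp_le hq, hEq]
    have h3 : r ^ (J + 1) ≤ r ^ J' := pow_le_pow_right₀ hr.le hJ
    rw [le_inv_comm₀ (by positivity) hr0, ← one_div, le_div_iff₀ (by positivity)]
    calc r * (r ^ J * z) = r ^ (J + 1) * z := by ring
      _ ≤ r ^ J' * z := by gcongr
      _ ≤ 1 := h1.le
  by_cases hex : ∃ J ∈ Finset.range N, E (clp r⁻¹ (r ^ J * z)) ≠ 0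
  · obtain ⟨J, hJ, hne⟩ := hex
    rw [Finset.sum_eq_single_of_mem J hJ]
    · exact hE _ (clp_bounds hq).1 (clp_bounds hq).2
    · intro K _ hKJ
      rcases lt_or_gt_of_ne hKJ with h | h
      · exact key K J h hne
      · by_contra h'
        exact hne (key J K h h')
  · push Not at hex
    rw [Finset.sum_eq_zero hex]
    simpa using hδ

set_option maxHeartbeats 2000000 in
lemma block_approx (α : ℝ) (hα : 0 < α) : ∃ (p C : ℕ) (BM Bm : ℝ), 1 ≤ C ∧ 0 < BM ∧ 0 < Bm ∧
    ∀ ε : ℝ, 0 < ε → ε ≤ 1 / 2 → ∃ (M m : ℕ) (r : ℝ) (g : Fin (p + 1) → ℝ),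
      1 ≤ M ∧ (M : ℝ) ≤ BM * (1 / ε) ^ (1 / α) ∧ (m : ℝ) ≤ Bm * Real.log (1 / ε) ∧
      1 < r ∧ r ^ M = 2 ∧ (∀ i, |g i| ≤ C) ∧
      (∀ y, r⁻¹ ≤ y → y ≤ 1 → |∑ i, g i * (1 - SQ m i y) + Real.log y| ≤ ε) ∧
      (∑ i, g i * (1 - SQ m i r⁻¹) + Real.log r⁻¹ = 0) := by
  set p := ⌈α⌉₊ with hp
  obtain ⟨c, C₁, hC₁, hexp⟩ := log_expansion p
  set Λ := ∑ i : Fin (p + 1), |c i| * 2 ^ (i : ℕ) with hΛ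
  have hΛ0 : 0 ≤ Λ := by positivity
  have hΛ4 : 0 ≤ Real.log (4 * (Λ + 1)) := Real.log_nonneg (by linarith)
  refine ⟨p, ⌈2 + 2 * Λ⌉₊, (4 * C₁) ^ (1 / α) + 1, 1 + 2 * (Real.log (4 * (Λ + 1)) + 1), ?_, by positivity,
    by positivity, ?_⟩
  · exact Nat.one_le_ceil_iff.2 (by positivity)
  intro ε hε hε2
  have hε1 : 1 ≤ 1 / ε := by rw [le_div_iff₀ hε]; linarith
  have hlog2 : 0.69 < Real.log 2 := by have := Real.log_two_gt_d9; linarith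
  have hlog2' : Real.log 2 < 0.7 := by have := Real.log_two_lt_d9; linarith
  have hlogε : Real.log 2 ≤ Real.log (1 / ε) := by
    apply Real.log_le_log (by norm_num)
    rw [le_div_iff₀ hε]; linarith
  set M := ⌈(4 * C₁ / ε) ^ (1 / α)⌉₊ with hM
  set m := ⌈Real.log (4 * (Λ + 1) / ε)⌉₊ with hm
  have hM1 : 1 ≤ M := Nat.one_le_ceil_iff.2 (by positivity)
  have hM1' : (1 : ℝ) ≤ M := by exact_mod_cast hM1
  have hMle : (4 * C₁ / ε) ^ (1 / α) ≤ M := Nat.le_ceil _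
  have hMα : 4 * C₁ / ε ≤ (M : ℝ) ^ α := by
    have := Real.rpow_le_rpow (by positivity) hMle hα.le
    rwa [← Real.rpow_mul (by positivity), one_div_mul_cancel hα.ne', Real.rpow_one] at this
  have hMp : (M : ℝ) ^ α ≤ (M : ℝ) ^ (p + 2) := by
    rw [← Real.rpow_natCast]
    apply Real.rpow_le_rpow_of_exponent_le hM1'
    push_cast
    have := Nat.le_ceil α
    linarith
  set r : ℝ := (2 : ℝ) ^ (1 / (M : ℝ)) with hr
  have hr1 : 1 < r := Real.one_lt_rpow (by norm_num) (by positivity)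
  have hr0 : 0 < r := by linarith
  have hrM : r ^ M = 2 := by
    rw [hr, ← Real.rpow_natCast, ← Real.rpow_mul (by norm_num), one_div_mul_cancel (by positivity),
      Real.rpow_one]
  have hrle : r ≤ 2 := by
    rw [← hrM]; exact le_self_pow₀ hr1.le (by omega)
  have hlogr : Real.log r = Real.log 2 / M := by
    rw [hr, Real.log_rpow (by norm_num)]; ring
  have hq1 : r⁻¹ < 1 := inv_lt_one_of_one_lt₀ hr1
  have hq0 : 0 < r⁻¹ := by positivity
  set H : ℝ → ℝ := fun y => ∑ i, c i * (1 - SQ m i y) with hH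
  have h4m : (1 / 4 : ℝ) ^ m ≤ ε / (4 * (Λ + 1)) := by
    have h1 : Real.log (4 * (Λ + 1) / ε) ≤ m := Nat.le_ceil _
    have h2 : 4 * (Λ + 1) / ε ≤ 4 ^ m := by
      calc _ = Real.exp (Real.log (4 * (Λ + 1) / ε)) := (Real.exp_log (by positivity)).symm
        _ ≤ Real.exp m := Real.exp_le_exp.2 h1
        _ = (Real.exp 1) ^ m := by rw [← Real.exp_nat_mul, mul_one]
        _ ≤ 4 ^ m := by
          gcongr
          have := Real.exp_one_lt_d9
          linarith
    rw [one_div, inv_pow, inv_le_comm₀ (by positivity) (by positivity), inv_div]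
    exact h2
  have hHerr : ∀ y, r⁻¹ ≤ y → y ≤ 1 → |H y + Real.log y| ≤ ε / 2 := by
    intro y hy hy1
    have hy0 : 0 < y := hq0.trans_le hy
    have ht0 : 0 ≤ -Real.log y := by have := Real.log_nonpos hy0.le hy1; linarith
    have htl : -Real.log y ≤ 1 / M := by
      have := Real.log_le_log hq0 hy
      rw [Real.log_inv, hlogr] at this
      have h3 : Real.log 2 / M ≤ 1 / M := by gcongr; linarith
      linarith
    have ht1 : -Real.log y ≤ 1 := htl.trans (by rw [div_le_one (by positivity)]; exact hM1')
    have h1 := hexp _ ht0 ht1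
    have h2 : C₁ * (-Real.log y) ^ (p + 2) ≤ ε / 4 := by
      calc _ ≤ C₁ * (1 / M) ^ (p + 2) := by gcongr
        _ = C₁ / M ^ (p + 2) := by rw [div_pow, one_pow]; ring
        _ ≤ C₁ / (4 * C₁ / ε) := by gcongr; exact hMα.trans hMp
        _ = ε / 4 := by field_simp
    have h3 : |H y - ∑ i, c i * (1 - Real.exp (-(2 ^ (i : ℕ) * -Real.log y)))| ≤ ε / 4 := by
      rw [hH]
      simp only
      rw [← Finset.sum_sub_distrib]
      calc _ ≤ ∑ i : Fin (p + 1), |c i| * 2 ^ (i : ℕ) * (1 / 4) ^ m := by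
            refine (Finset.abs_sum_le_sum_abs _ _).trans (Finset.sum_le_sum fun i _ => ?_)
            have e : Real.exp (-(2 ^ (i : ℕ) * -Real.log y)) = y ^ (2 ^ (i : ℕ)) := by
              rw [mul_neg, neg_neg]
              have : ((2 : ℝ) ^ (i : ℕ)) = ((2 ^ (i : ℕ) : ℕ) : ℝ) := by push_cast; rfl
              rw [this, Real.exp_nat_mul, Real.exp_log hy0]
            rw [e, ← mul_sub, abs_mul, mul_assoc]
            refine mul_le_mul_of_nonneg_left ?_ (abs_nonneg _)
            rw [sub_sub_sub_cancel_left, abs_sub_comm]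
            refine (SQ_err m i hy0.le hy1).trans ?_
            gcongr
            linarith
        _ = Λ * (1 / 4) ^ m := by rw [hΛ, Finset.sum_mul]
        _ ≤ (Λ + 1) * (ε / (4 * (Λ + 1))) := by gcongr; linarith
        _ = ε / 4 := by field_simp
    rw [abs_le] at h1 h3 ⊢
    constructor <;> linarith [h1.1, h1.2, h3.1, h3.2]
  set d := (Real.log r - H r⁻¹) / (1 - r⁻¹) with hd
  have hdq : d * (1 - r⁻¹) = Real.log r - H r⁻¹ := by
    rw [hd, div_mul_cancel₀]; linarith
  have hsum : ∀ y, ∑ i : Fin (p + 1), (c i + if i = 0 then d else 0) * (1 - SQ m i y)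
      = H y + d * (1 - y) := by
    intro y
    simp only [add_mul, Finset.sum_add_distrib, ite_mul, zero_mul, Finset.sum_ite_eq',
      Finset.mem_univ, if_true, hH]
    rfl
  have hdabs : |d| ≤ 2 + Λ := by
    rw [hd, abs_div, abs_of_pos (by linarith : 0 < 1 - r⁻¹), div_le_iff₀ (by linarith)]
    have h1 : |H r⁻¹| ≤ Λ * (1 - r⁻¹) := by
      rw [hΛ, Finset.sum_mul]
      refine (Finset.abs_sum_le_sum_abs _ _).trans (Finset.sum_le_sum fun i _ => ?_)
      rw [abs_mul, mul_assoc]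
      refine mul_le_mul_of_nonneg_left ?_ (abs_nonneg _)
      rw [abs_of_nonneg (by linarith [(SQ_bounds m i hq0.le hq1.le).2])]
      exact SQ_lip m i hq0.le hq1.le
    have h2 : Real.log r ≤ 2 * (1 - r⁻¹) := by
      have h3 := Real.log_le_sub_one_of_pos hr0
      have h4 : r * (1 - r⁻¹) = r - 1 := by field_simp
      nlinarith
    have h3 : 0 ≤ Real.log r := Real.log_nonneg hr1.le
    rw [abs_le] at h1 ⊢
    constructor <;> nlinarith [h1.1, h1.2]
  refine ⟨M, m, r, fun i => c i + if i = 0 then d else 0, hM1, ?_, ?_, hr1, hrM, ?_, ?_, ?_⟩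
  · have h1 := (Nat.ceil_lt_add_one (a := (4 * C₁ / ε) ^ (1 / α)) (by positivity)).le
    have h2 : (4 * C₁ / ε) ^ (1 / α) = (4 * C₁) ^ (1 / α) * (1 / ε) ^ (1 / α) := by
      rw [← Real.mul_rpow (by positivity) (by positivity)]
      congr 1; ring
    have h3 : 1 ≤ (1 / ε) ^ (1 / α) := Real.one_le_rpow hε1 (by positivity)
    rw [← hM, h2] at h1
    linarith
  · have h0 : Real.log (4 * (Λ + 1) / ε) = Real.log (4 * (Λ + 1)) + Real.log (1 / ε) := by
      rw [← Real.log_mul (by positivity) (by positivity)]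
      congr 1; ring
    have h1 := (Nat.ceil_lt_add_one (a := Real.log (4 * (Λ + 1) / ε)) (by rw [h0]; linarith)).le
    rw [← hm, h0] at h1
    have h5 : (Real.log (4 * (Λ + 1)) + 1) * 1 ≤
        (Real.log (4 * (Λ + 1)) + 1) * (2 * Real.log (1 / ε)) :=
      mul_le_mul_of_nonneg_left (by linarith) (by linarith)
    linarith
  · intro i
    have h1 : |c i| ≤ Λ := by
      calc |c i| ≤ |c i| * 2 ^ (i : ℕ) := le_mul_of_one_le_right (abs_nonneg _) (one_le_pow₀ (by norm_num))
        _ ≤ Λ := Finset.single_le_sum (f := fun i : Fin (p + 1) => |c i| * (2 : ℝ) ^ (i : ℕ))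
            (fun i _ => by positivity) (Finset.mem_univ i)
    have h2 : |if i = 0 then d else 0| ≤ 2 + Λ := by
      split_ifs
      · exact hdabs
      · simp; linarith
    refine le_trans ?_ (Nat.le_ceil _)
    exact (abs_add_le _ _).trans (by linarith)
  · intro y hy hy1
    rw [hsum]
    have h1 := hHerr y hy hy1
    have h2 := hHerr r⁻¹ le_rfl hq1.le
    rw [Real.log_inv] at h2
    have h3 : |d * (1 - y)| ≤ ε / 2 := by
      calc |d * (1 - y)| ≤ |d * (1 - r⁻¹)| := by
            rw [abs_mul, abs_mul, abs_of_nonneg (by linarith : 0 ≤ 1 - y),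
              abs_of_nonneg (by linarith : 0 ≤ 1 - r⁻¹)]
            gcongr
        _ ≤ ε / 2 := by
          rw [hdq, abs_sub_comm]; exact h2
    calc _ = |(H y + Real.log y) + d * (1 - y)| := by ring_nf
      _ ≤ _ := (abs_add_le _ _).trans (by linarith)
  · rw [hsum, hdq, Real.log_inv]; ring

/-- Theorem 2.3: ReLU network approximation of `log` near zero. -/
theorem statement3 (α : ℝ) (hα : 0 < α) :
    ∃ A₁ A₂ A₃ : ℝ, 0 < A₁ ∧ 0 < A₂ ∧ 0 < A₃ ∧
      ∀ a b ε : ℝ, a ∈ Set.Ioc (0 : ℝ) (1 / 2) → b ∈ Set.Ioc a 1 → ε ∈ Set.Ioc (0 : ℝ) (1 / 2) →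
        ∃ ft : (Fin 1 → ℝ) → ℝ,
          IsFNN 1 (A₁ * Real.log (1 / ε) + 139 * Real.log (1 / a))
            (A₂ * (1 / ε) ^ (1 / α) * Real.log (1 / a))
            (A₃ * (1 / ε) ^ (1 / α) * Real.log (1 / ε) * Real.log (1 / a)
              + 65440 * (Real.log (1 / a)) ^ 2)
            1 ⊤ ft ∧
          (∀ z ∈ Set.Icc a b, |Real.log z - ft (fun _ => z)| ≤ ε) ∧
          (∀ t : ℝ, Real.log a ≤ ft (fun _ => t) ∧ ft (fun _ => t) ≤ Real.log b) := by
  obtain ⟨p, C, BM, Bm, hC, hBM, hBm, H⟩ := block_approx α hα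
  have hC' : (0 : ℝ) < C := by exact_mod_cast hC
  refine ⟨p * (Bm + 2) + 10, 9 * BM * ((p + 1) * C),
    3 * BM * ((p + 1) * C) * (12 * p * (Bm + 2) + 102), by positivity, by positivity, by positivity, ?_⟩
  rintro a b ε ⟨ha0, ha2⟩ ⟨hab, hb1⟩ ⟨hε, hε2⟩
  obtain ⟨M, m, r, g, hM1, hM, hm, hr1, hrM, hg, herr, hend⟩ := H ε hε hε2
  have hlog2 : 0.69 < Real.log 2 := by have := Real.log_two_gt_d9; linarith
  have hlog2' : Real.log 2 < 0.7 := by have := Real.log_two_lt_d9; linarith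
  have hlogε : Real.log 2 ≤ Real.log (1 / ε) := by
    apply Real.log_le_log (by norm_num)
    rw [le_div_iff₀ hε]; linarith
  have hloga : Real.log 2 ≤ Real.log (1 / a) := by
    apply Real.log_le_log (by norm_num)
    rw [le_div_iff₀ ha0]; linarith
  have hb0 : 0 < b := ha0.trans hab
  have ea : Real.log (1 / a) = -Real.log a := by rw [one_div, Real.log_inv]
  set n := ⌈Real.log (1 / a) / Real.log 2⌉₊ with hn
  have hn1 : 1 ≤ n := Nat.one_le_ceil_iff.2 (by apply div_pos <;> linarith)
  have hnle : Real.log (1 / a) ≤ n * Real.log 2 := by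
    rw [← div_le_iff₀ (by linarith)]; exact Nat.le_ceil _
  have hnub : (n : ℝ) ≤ 3 * Real.log (1 / a) := by
    have h1 := (Nat.ceil_lt_add_one (a := Real.log (1 / a) / Real.log 2)
      (by apply div_nonneg <;> linarith)).le
    rw [← hn] at h1
    have h2 : Real.log (1 / a) / Real.log 2 + 1 ≤ 3 * Real.log (1 / a) := by
      rw [div_add_one (by linarith), div_le_iff₀ (by linarith)]
      nlinarith
    linarith
  have hnpos : (1 : ℝ) ≤ n := by exact_mod_cast hn1
  have hlob : 0 ≤ -Real.log b := by have := Real.log_nonpos hb0.le hb1; linarith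
  have hlohi : -Real.log b ≤ -Real.log a := by
    have := Real.log_le_log ha0 hab.le; linarith
  have hr0 : 0 < r := by linarith
  have hq1 : r⁻¹ ≤ 1 := inv_le_one_of_one_le₀ hr1.le
  have hm0 : (0 : ℝ) ≤ m := by positivity
  have hP1 : 0 < (1 / ε) ^ (1 / α) := by positivity
  have hK : ((n * M * ((p + 1) * C) : ℕ) : ℝ) ≤
      3 * BM * ((p + 1) * C) * ((1 / ε) ^ (1 / α) * Real.log (1 / a)) := by
    push_cast
    have hla0 : 0 ≤ 3 * Real.log (1 / a) := by linarith
    calc (n : ℝ) * M * ((p + 1) * C) ≤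
        (3 * Real.log (1 / a)) * (BM * (1 / ε) ^ (1 / α)) * ((p + 1) * C) := by
          gcongr
      _ = _ := by ring
  have net := network (N := 9 * BM * ((p + 1) * C) * (1 / ε) ^ (1 / α) * Real.log (1 / a))
    (G := (p * (Bm + 2) + 10) * Real.log (1 / ε) + 139 * Real.log (1 / a))
    (S' := 3 * BM * ((p + 1) * C) * (12 * p * (Bm + 2) + 102) * (1 / ε) ^ (1 / α) *
      Real.log (1 / ε) * Real.log (1 / a) + 65440 * (Real.log (1 / a)) ^ 2)
    n M p m C hn1 hM1 hC g hg r hr1.le hrM r⁻¹ (by positivity) hq1 (-Real.log b) (-Real.log a)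
    hlob hlohi (by nlinarith) (by
      push_cast at hK ⊢
      linarith) (by
      push_cast
      have h1 : (p : ℝ) * (m + 1) ≤ p * ((Bm + 2) * Real.log (1 / ε)) := by
        gcongr
        linarith
      linarith) (by
      rw [Nat.cast_add, Nat.cast_mul (n * M * ((p + 1) * C))]
      have h1 : ((18 * n ^ 2 : ℕ) : ℝ) ≤ 65440 * (Real.log (1 / a)) ^ 2 := by
        push_cast
        calc (18 : ℝ) * n ^ 2 ≤ 18 * (3 * Real.log (1 / a)) ^ 2 := by gcongr
          _ ≤ _ := by nlinarith [sq_nonneg (Real.log (1 / a))]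
      have h2 : ((12 * p * (m + 1) + 51 : ℕ) : ℝ) ≤ (12 * p * (Bm + 2) + 102) * Real.log (1 / ε) := by
        push_cast
        have h1 : (p : ℝ) * (m + 1) ≤ p * ((Bm + 2) * Real.log (1 / ε)) := by
          gcongr
          linarith
        linarith
      have h3 := mul_le_mul hK h2 (by positivity) (by
        have : 0 ≤ Real.log (1 / a) := by linarith
        positivity)
      linarith)
  refine ⟨_, net, ?_, ?_⟩
  · rintro z ⟨hza, hzb⟩
    have hz0 : 0 < z := ha0.trans_le hza
    have hz1 : z ≤ 1 := hzb.trans hb1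
    simp only [max_eq_left hz0.le]
    set s := ∑ J : Fin (n * M), ∑ i : Fin (p + 1), g i * (1 - SQ m i (clp r⁻¹ (r ^ (J : ℕ) * z)))
      with hs
    have hse : |s + Real.log z| ≤ ε := by
      have h1 := sum_err hr1 hz0 (fun y => ∑ i, g i * (1 - SQ m i y) + Real.log y)
        (by simp [SQ_one]) hend hε.le herr (n * M)
      have h2 := sum_log_clp hr1 hz0 hz1 (n * M)
      have h3 : Real.log 2 = M * Real.log r := by rw [← hrM, Real.log_pow]
      have h4 : -((n * M : ℕ) * Real.log r) ≤ Real.log z := by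
        push_cast
        rw [mul_assoc, ← h3]
        have := Real.log_le_log ha0 hza
        linarith
      rw [max_eq_left h4] at h2
      rw [Finset.sum_add_distrib, h2, Finset.sum_range] at h1
      exact h1
    have hlz1 := Real.log_le_log ha0 hza
    have hlz2 := Real.log_le_log hz0 hzb
    rw [abs_le] at hse ⊢
    rcases max_cases (s - -Real.log b) 0 with ⟨e1, f1⟩ | ⟨e1, f1⟩ <;>
    rcases max_cases (s - -Real.log a) 0 with ⟨e2, f2⟩ | ⟨e2, f2⟩ <;>
    rw [e1, e2] <;> constructor <;> linarith [hse.1, hse.2]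
  · intro t
    simp only
    generalize (∑ J : Fin (n * M), ∑ i : Fin (p + 1),
      g i * (1 - SQ m i (clp r⁻¹ (r ^ (J : ℕ) * max t 0)))) = s
    rcases max_cases (s - -Real.log b) 0 with ⟨e1, f1⟩ | ⟨e1, f1⟩ <;>
    rcases max_cases (s - -Real.log a) 0 with ⟨e2, f2⟩ | ⟨e2, f2⟩ <;>
    rw [e1, e2] <;> constructor <;> linarith

end

end DNNLogistic
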